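/- Let G be a simple graph with maximum degree at most d, let S ⊆ V be nonempty, and let P ⊆ S satisfy |P| ≤ |S|/2. Then the conductance of P in the projected Markov chain M_S satisfies Φ(P) ≥ |E_G(P, S∖P)|/(2d·|P|), where E_G(P, S∖P) is the set of edges of G with one endpoint in P and the other in S∖P. -/

import Mathlib

open scoped Classical

noncomputable section

/-- Transition matrix of the lazy random walk on `G` with step probability `1/(2d)`. -/
def lazyStep {V : Type*} [Fintype V] [DecidableEq V] (G : SimpleGraph V) [DecidableRel G.Adj]
    (d : ℕ) : Matrix V V ℝ :=
  Matrix.of fun u v =>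
    if G.Adj u v then 1 / (2 * d)
    else if u = v then 1 - (G.degree u : ℝ) / (2 * d)
    else 0

/-- `walkDist G d t s v` is the probability that the `t`-step lazy random walk from `s` ends
at `v`. -/
def walkDist {V : Type*} [Fintype V] [DecidableEq V] (G : SimpleGraph V) [DecidableRel G.Adj]
    (d t : ℕ) (s : V) : V → ℝ :=
  fun v => (lazyStep G d ^ t) s v

/-- The probability of a particular trajectory `w` of `t` steps of the lazy random walk. -/
def walkProb {V : Type*} [Fintype V] [DecidableEq V] (G : SimpleGraph V) [DecidableRel G.Adj]
    (d t : ℕ) (w : Fin (t + 1) → V) : ℝ :=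
  ∏ i : Fin t, lazyStep G d (w i.castSucc) (w i.succ)

/-- `projTrans G d S t u v`: the probability of the length-`t` transition from `u` to `v` in
the Markov chain projected onto `S`, i.e. the total probability of `t`-step lazy walks in `G`
from `u` to `v` whose intermediate vertices all lie outside `S`. -/
def projTrans {V : Type*} [Fintype V] [DecidableEq V] (G : SimpleGraph V) [DecidableRel G.Adj]
    (d : ℕ) (S : Finset V) (t : ℕ) (u v : V) : ℝ :=
  ∑ w : Fin (t + 1) → V,
    if w 0 = u ∧ w (Fin.last t) = v ∧
        (∀ i : Fin (t + 1), i ≠ 0 → i ≠ Fin.last t → w i ∉ S) then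
      walkProb G d t w
    else 0

/-- The number of edges of `G` with one endpoint in `A` and the other in `B`
(for disjoint `A`, `B`). -/
def crossCount {V : Type*} (G : SimpleGraph V) (A B : Finset V) : ℕ :=
  {p : V × V | p.1 ∈ A ∧ p.2 ∈ B ∧ G.Adj p.1 p.2}.ncard

/-- The one-hop transition probability from `u` to `v` in the projected chain `M_S`: the sum
over all lengths `t ≥ 1` of the length-`t` transition probabilities. -/
def oneHop {V : Type*} [Fintype V] [DecidableEq V] (G : SimpleGraph V) [DecidableRel G.Adj]
    (d : ℕ) (S : Finset V) (u v : V) : ℝ :=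
  ∑' t : ℕ, projTrans G d S (t + 1) u v

theorem sum_fin_cons {V : Type*} [Fintype V] {t : ℕ} (f : (Fin (t + 1) → V) → ℝ) :
    ∑ w, f w = ∑ a : V, ∑ w : Fin t → V, f (Fin.cons a w) := by
  rw [← Fintype.sum_prod_type' (fun a w => f (Fin.cons a w))]
  exact (Fintype.sum_equiv (Fin.consEquiv fun _ => V) _ _ fun _ => rfl).symm

theorem crossCount_eq_sum {V : Type*} (G : SimpleGraph V) [DecidableRel G.Adj] (A B : Finset V) :
    (crossCount G A B : ℝ) = ∑ u ∈ A, ∑ v ∈ B, if G.Adj u v then (1 : ℝ) else 0 := by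
  have h : {p : V × V | p.1 ∈ A ∧ p.2 ∈ B ∧ G.Adj p.1 p.2} =
      (((A ×ˢ B).filter fun p => G.Adj p.1 p.2 : Finset (V × V)) : Set (V × V)) := by
    ext p
    simp [and_assoc]
  rw [crossCount, h, Set.ncard_coe_finset, Finset.card_filter, Finset.sum_product]
  push_cast
  rfl

section ProjectedChain

variable {V : Type*} [Fintype V] [DecidableEq V] (G : SimpleGraph V) [DecidableRel G.Adj]
  {d : ℕ}

theorem lazyStep_nonneg (hd : 1 ≤ d) (hdeg : ∀ v, G.degree v ≤ d) (u v : V) :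
    0 ≤ lazyStep G d u v := by
  have hd' : (1 : ℝ) ≤ d := by exact_mod_cast hd
  have hu : (G.degree u : ℝ) ≤ d := by exact_mod_cast hdeg u
  simp only [lazyStep, Matrix.of_apply]
  split_ifs
  · positivity
  · rw [sub_nonneg, div_le_one (by positivity)]
    linarith
  · exact le_rfl

theorem sum_lazyStep (u : V) : ∑ v, lazyStep G d u v = 1 := by
  have h : ∀ v, lazyStep G d u v = (if G.Adj u v then (1 : ℝ) / (2 * d) else 0) +
      (if u = v then 1 - (G.degree u : ℝ) / (2 * d) else 0) := by
    intro v
    simp only [lazyStep, Matrix.of_apply]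
    by_cases huv : u = v
    · subst huv
      simp
    · simp [huv]
  simp only [h, Finset.sum_add_distrib, Finset.sum_ite_eq, Finset.mem_univ, if_true]
  rw [← Finset.sum_filter, Finset.sum_const, ← SimpleGraph.neighborFinset_eq_filter,
    SimpleGraph.card_neighborFinset_eq_degree, nsmul_eq_mul]
  ring

theorem walkProb_cons (t : ℕ) (a : V) (w : Fin (t + 1) → V) :
    walkProb G d (t + 1) (Fin.cons a w) = lazyStep G d a (w 0) * walkProb G d t w := by
  rw [walkProb, Fin.prod_univ_succ]
  simp [walkProb]

theorem projTrans_nonneg (hd : 1 ≤ d) (hdeg : ∀ v, G.degree v ≤ d) (S : Finset V) (t : ℕ)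
    (u v : V) : 0 ≤ projTrans G d S t u v := by
  refine Finset.sum_nonneg fun w _ => ?_
  split_ifs
  · exact Finset.prod_nonneg fun i _ => lazyStep_nonneg G hd hdeg _ _
  · exact le_rfl

theorem projTrans_one (S : Finset V) (u v : V) :
    projTrans G d S 1 u v = lazyStep G d u v := by
  have h : ∀ w : Fin 2 → V, (w 0 = u ∧ w (Fin.last 1) = v ∧
      (∀ i : Fin 2, i ≠ 0 → i ≠ Fin.last 1 → w i ∉ S)) ↔ w = ![u, v] := by
    intro w
    simp [funext_iff, Fin.forall_fin_two, Fin.last]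
  simp only [projTrans, h, Finset.sum_ite_eq', Finset.mem_univ, if_true]
  simp [walkProb]

theorem projTrans_add_two (S : Finset V) (t : ℕ) (u v : V) :
    projTrans G d S (t + 2) u v =
      ∑ x ∈ Sᶜ, lazyStep G d u x * projTrans G d S (t + 1) x v := by
  have hcond : ∀ (a : V) (w : Fin (t + 2) → V),
      ((Fin.cons a w : Fin (t + 3) → V) 0 = u ∧
        (Fin.cons a w : Fin (t + 3) → V) (Fin.last (t + 2)) = v ∧
        ∀ i : Fin (t + 3), i ≠ 0 → i ≠ Fin.last (t + 2) →
          (Fin.cons a w : Fin (t + 3) → V) i ∉ S) ↔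
      a = u ∧ w 0 ∈ Sᶜ ∧ w (Fin.last (t + 1)) = v ∧
        ∀ i : Fin (t + 2), i ≠ 0 → i ≠ Fin.last (t + 1) → w i ∉ S := by
    intro a w
    rw [← Fin.succ_last]
    simp only [Fin.cons_zero, Fin.cons_succ, Fin.forall_fin_succ (n := t + 2), ne_eq,
      Fin.succ_inj, Finset.mem_compl, not_true_eq_false, false_imp_iff, true_and,
      Fin.succ_ne_zero, not_false_eq_true, true_imp_iff]
    constructor
    · rintro ⟨ha, hv, hw⟩
      exact ⟨ha, hw 0 (Fin.last_pos.ne), hv, fun i _ hi => hw i hi⟩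
    · rintro ⟨ha, h0, hv, hw⟩
      refine ⟨ha, hv, fun i hi => ?_⟩
      by_cases hi0 : i = 0
      · rwa [hi0]
      · exact hw i hi0 hi
  simp only [projTrans, Finset.mul_sum]
  rw [sum_fin_cons, Finset.sum_comm, Finset.sum_comm (s := Sᶜ)]
  refine Finset.sum_congr rfl fun w _ => ?_
  simp only [hcond, walkProb_cons, mul_ite, mul_zero, ite_and, Finset.sum_ite_eq,
    Finset.sum_ite_eq', Finset.mem_univ, if_true]

theorem sum_range_projTrans_le_one (hd : 1 ≤ d) (hdeg : ∀ v, G.degree v ≤ d) {S : Finset V}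
    {v : V} (hv : v ∈ S) (n : ℕ) (u : V) :
    ∑ t ∈ Finset.range n, projTrans G d S (t + 1) u v ≤ 1 := by
  induction n generalizing u with
  | zero => simp
  | succ n ih =>
    rw [Finset.sum_range_succ', projTrans_one]
    simp only [projTrans_add_two]
    rw [Finset.sum_comm]
    simp only [← Finset.mul_sum]
    calc
      _ ≤ ∑ x ∈ Sᶜ, lazyStep G d u x + ∑ x ∈ S, lazyStep G d u x := by
        gcongr with x _
        · exact mul_le_of_le_one_right (lazyStep_nonneg G hd hdeg _ _) (ih x)
        · exact Finset.single_le_sum (f := fun x => lazyStep G d u x)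
            (fun x _ => lazyStep_nonneg G hd hdeg u x) hv
      _ = 1 := by rw [Finset.sum_compl_add_sum, sum_lazyStep]

theorem lazyStep_le_oneHop (hd : 1 ≤ d) (hdeg : ∀ v, G.degree v ≤ d) {S : Finset V} {v : V}
    (hv : v ∈ S) (u : V) : lazyStep G d u v ≤ oneHop G d S u v := by
  have hnonneg : ∀ t, 0 ≤ projTrans G d S (t + 1) u v := fun t =>
    projTrans_nonneg G hd hdeg S (t + 1) u v
  have hsum : Summable fun t => projTrans G d S (t + 1) u v :=
    summable_of_sum_range_le hnonneg fun n => sum_range_projTrans_le_one G hd hdeg hv n u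
  rw [← projTrans_one G S u v]
  exact hsum.le_tsum 0 fun t _ => hnonneg t

end ProjectedChain

/-- for `P ⊆ S` with `|P| ≤ |S|/2`, the conductance of `P` in the projected
chain `M_S` is at least `|E_G(P, S∖P)| / (2 d |P|)`. -/
theorem conductance_lower_bound {V : Type} [Fintype V] [DecidableEq V] (G : SimpleGraph V)
    [DecidableRel G.Adj] (d : ℕ) (hd : 1 ≤ d) (hdeg : ∀ v, G.degree v ≤ d)
    (S : Finset V) (hS : S.Nonempty) (P : Finset V) (hPS : P ⊆ S)
    (hhalf : (P.card : ℝ) ≤ (S.card : ℝ) / 2) :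
    (crossCount G P (S \ P) : ℝ) / (2 * d * P.card) ≤
      (∑ u ∈ P, ∑ v ∈ S \ P, oneHop G d S u v) /
        min (P.card : ℝ) (((S \ P).card : ℝ)) := by
  have hcard : ((S \ P).card : ℝ) = S.card - P.card := by
    rw [Finset.card_sdiff_of_subset hPS, Nat.cast_sub (Finset.card_le_card hPS)]
  rw [min_eq_left (by rw [hcard]; linarith), ← div_div]
  gcongr
  rw [crossCount_eq_sum, Finset.sum_div]
  refine Finset.sum_le_sum fun u _ => ?_
  rw [Finset.sum_div]
  refine Finset.sum_le_sum fun v hv => ?_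
  refine le_trans ?_ (lazyStep_le_oneHop G hd hdeg (Finset.mem_sdiff.mp hv).1 u)
  split_ifs with h
  · simp [lazyStep, h]
  · simpa using lazyStep_nonneg G hd hdeg u v
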